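/- arXiv:1912.08296 — 2 statements merged into one kernel-verified Lean document; each statement's English description precedes it below -/
import Mathlib

section
/- Let (X, X') and (Y, Y') be two pairs of isogonal conjugates in quadrilateral ABCD. Then the points XY ∩ X'Y' and XY' ∩ X'Y (when they exist and are finite) are excellent points of ABCD, i.e., they lie on the isogonal cubic of ABCD. -/
open Complex ComplexConjugate

/-- `x` is an excellent point of the quadrilateral `abcd`: the line pairs `(xa, xc)` and
`(xb, xd)` are isogonal, i.e. `x` lies on the isogonal cubic of `abcd`. -/
def Excellent (a b c d x : ℂ) : Prop :=
  ((a - x) * (c - x) * conj ((b - x) * (d - x))).im = 0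

/-- `p` and `q` are isogonal conjugates in the quadrilateral `v₁v₂v₃v₄`. -/
def IsogConjIn (v₁ v₂ v₃ v₄ p q : ℂ) : Prop :=
  ((p - v₁) * (q - v₁) * conj ((v₂ - v₁) * (v₄ - v₁))).im = 0 ∧
  ((p - v₂) * (q - v₂) * conj ((v₁ - v₂) * (v₃ - v₂))).im = 0 ∧
  ((p - v₃) * (q - v₃) * conj ((v₂ - v₃) * (v₄ - v₃))).im = 0 ∧
  ((p - v₄) * (q - v₄) * conj ((v₃ - v₄) * (v₁ - v₄))).im = 0


lemma qc_col {S : Set ℂ} (α β : ℂ) (hβ : β ≠ 0) (h : ∀ v ∈ S, (α + β * v).im = 0) :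
    Collinear ℝ S := by
  rw [collinear_iff_exists_forall_eq_smul_vadd]
  refine ⟨-α / β, 1 / β, fun v hv => ⟨(α + β * v).re, ?_⟩⟩
  have h1 : ((α + β * v).re : ℂ) = α + β * v := by
    apply Complex.ext
    · simp
    · rw [h v hv]; simp
  rw [vadd_eq_add, Complex.real_smul, h1]
  field_simp
  ring

lemma qc_div {u w : ℂ} (h : (u * conj w).im = 0) : (u / w).im = 0 := by
  rw [Complex.div_im]
  simp only [Complex.mul_im, Complex.conj_re, Complex.conj_im] at h
  have : u.im * w.re - u.re * w.im = 0 := by linarith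
  rw [← sub_div, this, zero_div]

lemma qc_key (a b c d x x' : ℂ)
    (hab : a ≠ b) (had : a ≠ d) (hbc : b ≠ c) (hcd : c ≠ d)
    (hnp : a + c ≠ b + d) (hncol : ¬ Collinear ℝ ({a, b, c, d} : Set ℂ))
    (hx : IsogConjIn a b c d x x') :
    ∃ t : ℝ, x * x' = a * c + t * (a * c - b * d) ∧ x + x' = a + c + t * (a + c - b - d) := by
  obtain ⟨h1, h2, h3, h4⟩ := hx
  have he : a + c - b - d ≠ 0 := by
    intro h; apply hnp; linear_combination h
  have e1 : b - a ≠ 0 := sub_ne_zero.2 hab.symm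
  have e2 : d - a ≠ 0 := sub_ne_zero.2 had.symm
  have e3 : b - c ≠ 0 := sub_ne_zero.2 hbc
  have e4 : d - c ≠ 0 := sub_ne_zero.2 hcd.symm
  have e1' : a - b ≠ 0 := sub_ne_zero.2 hab
  have e2' : a - d ≠ 0 := sub_ne_zero.2 had
  have e3' : c - b ≠ 0 := sub_ne_zero.2 hbc.symm
  have e4' : c - d ≠ 0 := sub_ne_zero.2 hcd
  replace h1 := qc_div h1
  replace h2 := qc_div h2
  replace h3 := qc_div h3
  replace h4 := qc_div h4
  obtain ⟨e, hee⟩ : ∃ e, e = a + c - b - d := ⟨_, rfl⟩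
  rw [← hee] at he
  obtain ⟨z, hz⟩ : ∃ z, e * z = a * c - b * d := ⟨(a * c - b * d) / e, by field_simp⟩
  -- e (v - z) at the vertices
  have da : e * (a - z) = (b - a) * (d - a) := by rw [mul_sub, hz, hee]; ring
  have db : e * (b - z) = -((a - b) * (c - b)) := by rw [mul_sub, hz, hee]; ring
  have dc : e * (c - z) = (b - c) * (d - c) := by rw [mul_sub, hz, hee]; ring
  have dd : e * (d - z) = -((c - d) * (a - d)) := by rw [mul_sub, hz, hee]; ring
  have za : a - z ≠ 0 := by
    intro h; rw [h, mul_zero] at da; exact mul_ne_zero e1 e2 da.symm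
  have zc : c - z ≠ 0 := by
    intro h; rw [h, mul_zero] at dc; exact mul_ne_zero e3 e4 dc.symm
  have zb : b - z ≠ 0 := by
    intro h; rw [h, mul_zero] at db; exact neg_ne_zero.2 (mul_ne_zero e1' e3') db.symm
  have zd : d - z ≠ 0 := by
    intro h; rw [h, mul_zero] at dd; exact neg_ne_zero.2 (mul_ne_zero e4' e2') dd.symm
  have hk : (a - z) * (c - z) = (b - z) * (d - z) := by
    linear_combination (-1 : ℂ) * hz + z * hee
  -- the difference polynomial L w = μ - σ w
  obtain ⟨μ, hμ⟩ : ∃ μ, μ = x * x' - a * c := ⟨_, rfl⟩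
  obtain ⟨σ, hσ⟩ : ∃ σ, σ = x + x' - a - c := ⟨_, rfl⟩
  obtain ⟨k, hkk⟩ : ∃ k, k = (a - z) * (c - z) := ⟨_, rfl⟩
  have hk0 : k ≠ 0 := by rw [hkk]; exact mul_ne_zero za zc
  obtain ⟨β, hβ⟩ : ∃ β, β = (μ - σ * z) / (e * k) := ⟨_, rfl⟩
  obtain ⟨α, hα⟩ : ∃ α, α = - σ / e - β * z := ⟨_, rfl⟩
  have gen : ∀ v w, v - z ≠ 0 → (v - z) * (w - z) = k →
      α + β * w = (μ - σ * v) / (e * (v - z)) := by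
    intro v w hv hvw
    have hw : w - z ≠ 0 := by
      intro h; rw [h, mul_zero] at hvw; exact hk0 hvw.symm
    have : α + β * w = -σ / e + β * (w - z) := by rw [hα]; ring
    rw [this, hβ, ← hvw]
    field_simp
    ring
  have gc := gen a c za hkk.symm
  have ga := gen c a zc (by rw [hkk]; ring)
  have gd := gen b d zb (by rw [hkk, hk])
  have gb := gen d b zd (by rw [hkk, hk]; ring)
  have ic : (α + β * c).im = 0 := by
    rw [gc, da]; rw [← h1]; congr 2; rw [hμ, hσ]; ring
  have ia : (α + β * a).im = 0 := by
    rw [ga, dc]; rw [← h3]; congr 2; rw [hμ, hσ]; ring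
  have id' : (α + β * d).im = 0 := by
    have : α + β * d = 1 - (x - b) * (x' - b) / ((a - b) * (c - b)) := by
      rw [gd, db, hμ, hσ]; field_simp; ring
    rw [this, Complex.sub_im, h2]; simp
  have ib : (α + β * b).im = 0 := by
    have : α + β * b = 1 - (x - d) * (x' - d) / ((c - d) * (a - d)) := by
      rw [gb, dd, hμ, hσ]; field_simp; ring
    rw [this, Complex.sub_im, h4]; simp
  have hβ0 : β = 0 := by
    by_contra hne
    apply hncol
    apply qc_col α β hne
    intro v hv
    simp only [Set.mem_insert_iff, Set.mem_singleton_iff] at hv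
    rcases hv with rfl | rfl | rfl | rfl <;> assumption
  have hL : μ - σ * z = 0 := by
    rw [hβ, div_eq_zero_iff] at hβ0
    exact hβ0.resolve_right (mul_ne_zero he hk0)
  have hαr : ((-α).re : ℂ) = -α := by
    apply Complex.ext
    · simp
    · rw [hβ0] at ic; simp at ic; simp [ic]
  have hαe : -α * e = σ := by
    rw [hα, hβ0]; field_simp; ring
  refine ⟨(-α).re, ?_, ?_⟩
  · rw [hαr]; linear_combination (-1 : ℂ) * hμ + hL - z * hαe - α * hz
  · rw [hαr]; linear_combination (-1 : ℂ) * hσ - hαe - α * hee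

lemma qc_colim {x y z : ℂ} (h : Collinear ℝ ({x, y, z} : Set ℂ)) :
    ((x - z) * conj (y - z)).im = 0 := by
  rw [collinear_iff_of_mem (p₀ := z) (by simp)] at h
  obtain ⟨v, hv⟩ := h
  obtain ⟨r, hr⟩ := hv x (by simp)
  obtain ⟨s, hs⟩ := hv y (by simp)
  rw [hr, hs]
  simp
  ring

lemma qc_fin (a b c d x x' y y' z : ℂ) (t s : ℝ)
    (h1 : x * x' = a * c + t * (a * c - b * d)) (h2 : x + x' = a + c + t * (a + c - b - d))
    (h3 : y * y' = a * c + s * (a * c - b * d)) (h4 : y + y' = a + c + s * (a + c - b - d))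
    (hxy : x ≠ y) (hxy' : x ≠ y')
    (c1 : Collinear ℝ ({x, y, z} : Set ℂ)) (c2 : Collinear ℝ ({x', y', z} : Set ℂ)) :
    Excellent a b c d z := by
  have hts : t - s ≠ 0 := by
    intro h
    have hts : t = s := sub_eq_zero.1 h
    subst hts
    have : (x - y) * (x - y') = 0 := by linear_combination x * (h2 - h4) - h1 + h3
    rcases mul_eq_zero.1 this with h | h
    · exact hxy (sub_eq_zero.1 h)
    · exact hxy' (sub_eq_zero.1 h)
  have i1 := qc_colim c1
  have i2 := qc_colim c2
  have i3 : (((x - z) * (x' - z)) * conj ((y - z) * (y' - z))).im = 0 := by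
    have : ((x - z) * (x' - z)) * conj ((y - z) * (y' - z))
        = ((x - z) * conj (y - z)) * ((x' - z) * conj (y' - z)) := by
      rw [map_mul]; ring
    rw [this, Complex.mul_im, i1, i2]; ring
  have hF : (x - z) * (x' - z) = (a - z) * (c - z)
      + t * ((a - z) * (c - z) - (b - z) * (d - z)) := by
    linear_combination h1 - z * h2
  have hG : (y - z) * (y' - z) = (a - z) * (c - z)
      + s * ((a - z) * (c - z) - (b - z) * (d - z)) := by
    linear_combination h3 - z * h4
  rw [hF, hG] at i3
  unfold Excellent
  generalize (a - z) * (c - z) = P at *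
  generalize (b - z) * (d - z) = Q at *
  simp at i3 ⊢
  apply mul_left_cancel₀ hts
  linear_combination i3

/-- quadrilateral completeness: for two pairs `(x, x')`, `(y, y')` of
isogonal conjugates in `abcd`, the finite intersection points `z₁ = xy ∩ x'y'` and
`z₂ = xy' ∩ x'y` (when the corresponding lines are distinct and non-parallel) are
excellent points of `abcd`, i.e. they lie on the isogonal cubic. -/
theorem quadrilateral_completeness (a b c d x x' y y' z₁ z₂ : ℂ)
    (hab : a ≠ b) (hac : a ≠ c) (had : a ≠ d) (hbc : b ≠ c) (hbd : b ≠ d) (hcd : c ≠ d)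
    (hnp : a + c ≠ b + d) (hncol : ¬ Collinear ℝ ({a, b, c, d} : Set ℂ))
    (hxx' : x ≠ x') (hyy' : y ≠ y') (hxy : x ≠ y) (hxy' : x ≠ y')
    (hx'y : x' ≠ y) (hx'y' : x' ≠ y')
    (hx : IsogConjIn a b c d x x') (hy : IsogConjIn a b c d y y')
    (hpar1 : ((y - x) * conj (y' - x')).im ≠ 0)
    (hz1 : Collinear ℝ ({x, y, z₁} : Set ℂ) ∧ Collinear ℝ ({x', y', z₁} : Set ℂ))
    (hpar2 : ((y' - x) * conj (y - x')).im ≠ 0)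
    (hz2 : Collinear ℝ ({x, y', z₂} : Set ℂ) ∧ Collinear ℝ ({x', y, z₂} : Set ℂ)) :
    Excellent a b c d z₁ ∧ Excellent a b c d z₂ := by
  obtain ⟨t, h1, h2⟩ := qc_key a b c d x x' hab had hbc hcd hnp hncol hx
  obtain ⟨s, h3, h4⟩ := qc_key a b c d y y' hab had hbc hcd hnp hncol hy
  exact ⟨qc_fin a b c d x x' y y' z₁ t s h1 h2 h3 h4 hxy hxy' hz1.1 hz1.2,
    qc_fin a b c d x x' y' y z₂ t s h1 h2 (by rw [mul_comm, h3]) (by rw [add_comm, h4])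
      hxy' hxy hz2.1 hz2.2⟩
end

section
/- Let F(x,y,z) = 0 define a nondegenerate cubic 𝒞 in \mathbb{CP}^2 and let X be a nonsingular point on 𝒞. Then there are at most 4 points Y on 𝒞 distinct from X such that the line XY meets 𝒞 at Y with multiplicity at least 2 (i.e., Y is singular or XY is tangent at Y). -/
open MvPolynomial

noncomputable def cub (a b c d e f g h k l : ℂ) : MvPolynomial (Fin 3) ℂ :=
  C a * X 0 ^ 3 + C b * (X 0 ^ 2 * X 1) + C c * (X 0 ^ 2 * X 2) + C d * (X 0 * X 1 ^ 2)
  + C e * (X 0 * X 1 * X 2) + C f * (X 0 * X 2 ^ 2) + C g * X 1 ^ 3 + C h * (X 1 ^ 2 * X 2)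
  + C k * (X 1 * X 2 ^ 2) + C l * X 2 ^ 3

lemma exists_cub (F : MvPolynomial (Fin 3) ℂ) (h3 : F.IsHomogeneous 3) :
    ∃ a b c d e f g h k l, F = cub a b c d e f g h k l := by
  rw [F.as_sum]
  apply Finset.sum_induction _ (fun F => ∃ a b c d e f g h k l, F = cub a b c d e f g h k l)
  · rintro _ _ ⟨a, b, c, d, e, f, g, h, k, l, rfl⟩ ⟨a', b', c', d', e', f', g', h', k', l', rfl⟩
    refine ⟨a + a', b + b', c + c', d + d', e + e', f + f', g + g', h + h', k + k', l + l', ?_⟩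
    simp only [cub, C_add]
    ring
  · exact ⟨0, 0, 0, 0, 0, 0, 0, 0, 0, 0, by simp [cub]⟩
  · intro m hm
    have hd := h3 (mem_support_iff.mp hm)
    simp only [Finsupp.weight_apply, Finsupp.sum_fintype, Fin.sum_univ_three, Pi.one_apply,
      smul_eq_mul, mul_one, zero_mul, implies_true] at hd
    generalize coeff m F = t
    have hmon : monomial m t = C t * (X 0 ^ m 0 * X 1 ^ m 1 * X 2 ^ m 2) := by
      rw [monomial_eq, Finsupp.prod_fintype _ _ (by simp), Fin.prod_univ_three]
    rw [hmon]
    generalize m 0 = p at *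
    generalize m 1 = q at *
    generalize m 2 = r at *
    have hp : p ≤ 3 := by omega
    have hq : q ≤ 3 := by omega
    obtain rfl : r = 3 - p - q := by omega
    clear hmon
    interval_cases p <;> interval_cases q <;> first
      | (exfalso; omega)
      | skip
    · exact ⟨0, 0, 0, 0, 0, 0, 0, 0, 0, t, by simp [cub]⟩
    · exact ⟨0, 0, 0, 0, 0, 0, 0, 0, t, 0, by simp [cub]⟩
    · exact ⟨0, 0, 0, 0, 0, 0, 0, t, 0, 0, by simp [cub]⟩
    · exact ⟨0, 0, 0, 0, 0, 0, t, 0, 0, 0, by simp [cub]⟩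
    · exact ⟨0, 0, 0, 0, 0, t, 0, 0, 0, 0, by simp [cub]⟩
    · exact ⟨0, 0, 0, 0, t, 0, 0, 0, 0, 0, by simp [cub]⟩
    · exact ⟨0, 0, 0, t, 0, 0, 0, 0, 0, 0, by simp [cub]⟩
    · exact ⟨0, 0, t, 0, 0, 0, 0, 0, 0, 0, by simp [cub]⟩
    · exact ⟨0, t, 0, 0, 0, 0, 0, 0, 0, 0, by simp [cub]⟩
    · exact ⟨t, 0, 0, 0, 0, 0, 0, 0, 0, 0, by simp [cub]⟩

lemma four_of_card {m : Multiset ℂ} (hm : m.card ≤ 4) :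
    ∃ r₁ r₂ r₃ r₄ : ℂ, ∀ z ∈ m, z = r₁ ∨ z = r₂ ∨ z = r₃ ∨ z = r₄ := by
  induction m using Quotient.inductionOn with
  | h L =>
    simp only [Multiset.quot_mk_to_coe, Multiset.coe_card, Multiset.mem_coe] at *
    match L, hm with
    | [], _ => exact ⟨0, 0, 0, 0, by simp⟩
    | [a], _ => exact ⟨a, 0, 0, 0, by simp only [List.mem_cons, List.not_mem_nil]; tauto⟩
    | [a, b], _ => exact ⟨a, b, 0, 0, by simp only [List.mem_cons, List.not_mem_nil]; tauto⟩
    | [a, b, c], _ => exact ⟨a, b, c, 0, by simp only [List.mem_cons, List.not_mem_nil]; tauto⟩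
    | [a, b, c, d], _ => exact ⟨a, b, c, d, by simp⟩
    | a :: b :: c :: d :: e :: L, h => simp at h; omega

lemma not_irr {G A B : MvPolynomial (Fin 3) ℂ} (hG : Irreducible G) (h : G = A * B)
    (hA : eval 0 A = 0) (hB : eval 0 B = 0) : False := by
  rcases hG.isUnit_or_isUnit h with h | h
  · have := h.map (eval (0 : Fin 3 → ℂ)); rw [hA] at this; simp at this
  · have := h.map (eval (0 : Fin 3 → ℂ)); rw [hB] at this; simp at this

lemma core {d e f g h k l : ℂ} (hG : Irreducible (cub 0 1 0 d e f g h k l)) :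
    ∃ Y₁ Y₂ Y₃ Y₄ : Fin 3 → ℂ, ∀ u : Fin 3 → ℂ, (u 1 ≠ 0 ∨ u 2 ≠ 0) →
      eval u (cub 0 1 0 d e f g h k l) = 0 → eval u (pderiv 0 (cub 0 1 0 d e f g h k l)) = 0 →
        (∃ t : ℂ, u = t • Y₁) ∨ (∃ t : ℂ, u = t • Y₂) ∨
        (∃ t : ℂ, u = t • Y₃) ∨ (∃ t : ℂ, u = t • Y₄) := by
  let p : Polynomial ℂ := Polynomial.C (f ^ 2) * Polynomial.X ^ 4
    + Polynomial.C (2 * e * f - 4 * l) * Polynomial.X ^ 3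
    + Polynomial.C (2 * d * f + e ^ 2 - 4 * k) * Polynomial.X ^ 2
    + Polynomial.C (2 * d * e - 4 * h) * Polynomial.X
    + Polynomial.C (d ^ 2 - 4 * g)
  have hpd : p.natDegree ≤ 4 := by
    simp only [p]; compute_degree
  have hp0 : p ≠ 0 := by
    intro hp
    have h4 : f ^ 2 = 0 := by
      have := congrArg (fun q => Polynomial.coeff q 4) hp
      simpa [p, -map_sub, -map_add, -map_mul, -map_pow, Polynomial.coeff_X, Polynomial.coeff_C, Polynomial.coeff_X_pow] using this
    have h3 : 2 * e * f - 4 * l = 0 := by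
      have := congrArg (fun q => Polynomial.coeff q 3) hp
      simpa [p, -map_sub, -map_add, -map_mul, -map_pow, Polynomial.coeff_X, Polynomial.coeff_C, Polynomial.coeff_X_pow] using this
    have h2 : 2 * d * f + e ^ 2 - 4 * k = 0 := by
      have := congrArg (fun q => Polynomial.coeff q 2) hp
      simpa [p, -map_sub, -map_add, -map_mul, -map_pow, Polynomial.coeff_X, Polynomial.coeff_C, Polynomial.coeff_X_pow] using this
    have h1 : 2 * d * e - 4 * h = 0 := by
      have := congrArg (fun q => Polynomial.coeff q 1) hp
      simpa [p, -map_sub, -map_add, -map_mul, -map_pow, Polynomial.coeff_X, Polynomial.coeff_C, Polynomial.coeff_X_pow] using this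
    have h0 : d ^ 2 - 4 * g = 0 := by
      have := congrArg (fun q => Polynomial.coeff q 0) hp
      simpa [p, -map_sub, -map_add, -map_mul, -map_pow, Polynomial.coeff_X, Polynomial.coeff_C, Polynomial.coeff_X_pow] using this
    have hf : f = 0 := by simpa using h4
    subst hf
    obtain ⟨d, rfl⟩ : ∃ d', d = 2 * d' := ⟨d / 2, by ring⟩
    obtain ⟨e, rfl⟩ : ∃ d', e = 2 * d' := ⟨e / 2, by ring⟩
    obtain rfl : l = 0 := by linear_combination -h3 / 4
    obtain rfl : k = e ^ 2 := by linear_combination -h2 / 4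
    obtain rfl : h = 2 * d * e := by linear_combination -h1 / 4
    obtain rfl : g = d ^ 2 := by linear_combination -h0 / 4
    refine not_irr hG (A := X 1) (B := (X 0 + C d * X 1 + C e * X 2) ^ 2) ?_ (by simp) (by simp)
    simp only [cub, map_mul, map_pow, map_zero, map_one, map_ofNat]
    ring
  obtain ⟨r₁, r₂, r₃, r₄, hr⟩ := four_of_card (p.card_roots'.trans hpd)
  let Y : ℂ → Fin 3 → ℂ := fun z => ![-(d + e * z + f * z ^ 2) / 2, 1, z]
  refine ⟨Y r₁, Y r₂, Y r₃, Y r₄, ?_⟩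
  intro u hu hF hP
  simp only [cub, map_add, map_mul, map_pow, eval_X, eval_C, Derivation.leibniz,
    Derivation.leibniz_pow, pderiv_C, pderiv_X, smul_eq_mul, map_zero, map_one] at hF hP
  simp [Pi.single_apply] at hF hP
  generalize hx : u 0 = x at *
  generalize hy : u 1 = y at *
  generalize hz : u 2 = z at *
  have hy0 : y ≠ 0 := by
    rintro rfl
    have hz0 : z ≠ 0 := by simpa using hu
    have hf : f = 0 := by simpa [hz0] using hP
    have hl : l = 0 := by simpa [hz0, hf] using hF
    subst hf hl
    refine not_irr hG (A := X 1) (B := X 0 ^ 2 + C d * (X 0 * X 1) + C e * (X 0 * X 2) + C g * X 1 ^ 2 + C h * (X 1 * X 2) + C k * X 2 ^ 2) ?_ (by simp) (by simp)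
    simp only [cub, map_mul, map_pow, map_zero, map_one, map_ofNat]
    ring
  have key : u = y • Y (z / y) := by
    ext i
    fin_cases i
    · simp [Y, hx]
      field_simp
      linear_combination hP
    · simp [Y, hy]
    · simp [Y, hz]; field_simp
  have hroot : z / y ∈ p.roots := by
    rw [Polynomial.mem_roots hp0]
    simp only [Polynomial.IsRoot, p, Polynomial.eval_add, Polynomial.eval_mul, Polynomial.eval_pow, Polynomial.eval_X, Polynomial.eval_C]
    field_simp
    have : (2 * x * y + (d * y ^ 2 + e * y * z + f * z ^ 2)) = 0 := by linear_combination hP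
    linear_combination (2 * x * y + (d * y ^ 2 + e * y * z + f * z ^ 2)) * this - 4 * y * hF
  rcases hr _ hroot with h | h | h | h
  · exact .inl ⟨y, h ▸ key⟩
  · exact .inr (.inl ⟨y, h ▸ key⟩)
  · exact .inr (.inr (.inl ⟨y, h ▸ key⟩))
  · exact .inr (.inr (.inr ⟨y, h ▸ key⟩))

lemma chain (f : Fin 3 → MvPolynomial (Fin 3) ℂ) (j : Fin 3) (F : MvPolynomial (Fin 3) ℂ) :
    pderiv j (bind₁ f F) = ∑ i, bind₁ f (pderiv i F) * pderiv j (f i) := by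
  induction F using MvPolynomial.induction_on with
  | C a => simp
  | add p q hp hq => simp [hp, hq, add_mul, Finset.sum_add_distrib]
  | mul_X p i hp =>
    simp only [map_mul, Derivation.leibniz, bind₁_X_right, smul_eq_mul, hp, map_add, pderiv_X]
    fin_cases i <;> simp [Fin.sum_univ_three, Pi.single_apply] <;> ring

noncomputable def lin (M : Matrix (Fin 3) (Fin 3) ℂ) (i : Fin 3) : MvPolynomial (Fin 3) ℂ :=
  ∑ j, C (M i j) * X j

lemma lin_comp {M N : Matrix (Fin 3) (Fin 3) ℂ} (h : M * N = 1) :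
    (bind₁ (lin N)).comp (bind₁ (lin M)) = AlgHom.id ℂ _ := by
  apply MvPolynomial.algHom_ext
  intro i
  have h' : ∀ j, M i 0 * N 0 j + M i 1 * N 1 j + M i 2 * N 2 j = (1 : Matrix _ _ ℂ) i j := by
    intro j
    rw [← h, Matrix.mul_apply, Fin.sum_univ_three]
  have : bind₁ (lin N) (lin M i) = ∑ j, C ((1 : Matrix _ _ ℂ) i j) * X j := by
    simp only [← h', lin, Fin.sum_univ_three, map_add, map_mul, bind₁_X_right, bind₁_C_right]
    ring
  simp only [AlgHom.comp_apply, bind₁_X_right, this, AlgHom.id_apply]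
  fin_cases i <;> simp [Fin.sum_univ_three, Matrix.one_apply]

lemma eval_lin (M : Matrix (Fin 3) (Fin 3) ℂ) (u : Fin 3 → ℂ) (F : MvPolynomial (Fin 3) ℂ) :
    eval u (bind₁ (lin M) F) = eval (M.mulVec u) F := by
  induction F using MvPolynomial.induction_on with
  | C a => simp
  | add p q hp hq => simp [hp, hq]
  | mul_X p i hp => simp [hp, lin, Matrix.mulVec, dotProduct]

lemma exists_dual (v : Fin 3 → ℂ) (hv : ∃ i, v i ≠ 0) :
    ∃ W : Fin 3 → ℂ, v 0 * W 0 + v 1 * W 1 + v 2 * W 2 = 1 := by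
  obtain ⟨i, hi⟩ := hv
  refine ⟨Pi.single i (v i)⁻¹, ?_⟩
  fin_cases i <;> simpa using mul_inv_cancel₀ hi

/-- let `F = 0` define an irreducible (nondegenerate) cubic in `ℂP²` and let
`X` be a nonsingular point on it.  Then there are at most 4 projective points `Y` on the
cubic, distinct from `X`, such that the line `XY` meets the cubic at `Y` with multiplicity
at least 2 — i.e. `Y` is a singular point or `XY` is tangent at `Y`; both cases are
captured by the polar condition `∑ Xᵢ ∂ᵢF(Y) = 0`. -/
theorem at_most_four_tangent_points (F : MvPolynomial (Fin 3) ℂ)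
    (h3 : F.IsHomogeneous 3) (hirr : Irreducible F)
    (X : Fin 3 → ℂ) (hX0 : X ≠ 0)
    (hXon : eval X F = 0)
    (hXns : ¬ ∀ i, eval X (pderiv i F) = 0) :
    ∃ Y₁ Y₂ Y₃ Y₄ : Fin 3 → ℂ,
      ∀ y : Fin 3 → ℂ, y ≠ 0 → eval y F = 0 →
        (∑ i, X i * eval y (pderiv i F)) = 0 →
        (¬ ∃ t : ℂ, y = t • X) →
        (∃ t : ℂ, y = t • Y₁) ∨ (∃ t : ℂ, y = t • Y₂) ∨
        (∃ t : ℂ, y = t • Y₃) ∨ (∃ t : ℂ, y = t • Y₄) := by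
  obtain ⟨W, hW⟩ := exists_dual (fun i => eval X (pderiv i F)) (by simpa using hXns)
  obtain ⟨U, hU⟩ := exists_dual X (by
    by_contra! hc
    exact hX0 (funext hc))
  have hE := congrArg (eval X) h3.sum_X_mul_pderiv
  simp only [Fin.sum_univ_three, map_add, map_mul, eval_X, map_nsmul, hXon, smul_zero] at hE
  generalize hv0 : eval X (pderiv 0 F) = v0 at *
  generalize hv1 : eval X (pderiv 1 F) = v1 at *
  generalize hv2 : eval X (pderiv 2 F) = v2 at *
  let M : Matrix (Fin 3) (Fin 3) ℂ :=
    !![X 0, W 0, v1 * U 2 - v2 * U 1; X 1, W 1, v2 * U 0 - v0 * U 2;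
      X 2, W 2, v0 * U 1 - v1 * U 0]
  have hdet : M.det = -1 := by
    simp only [M, Matrix.det_fin_three, Matrix.of_apply, Matrix.cons_val]
    linear_combination (-(X 0 * U 0 + X 1 * U 1 + X 2 * U 2)) * hW - hU
      + (W 0 * U 0 + W 1 * U 1 + W 2 * U 2) * hE
  have hu : IsUnit M.det := by rw [hdet]; simp
  have hMN : M * M⁻¹ = 1 := M.mul_nonsing_inv hu
  have hNM : M⁻¹ * M = 1 := M.nonsing_inv_mul hu
  let Φ : MvPolynomial (Fin 3) ℂ ≃ₐ[ℂ] MvPolynomial (Fin 3) ℂ :=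
    AlgEquiv.ofAlgHom (bind₁ (lin M)) (bind₁ (lin M⁻¹)) (lin_comp hNM) (lin_comp hMN)
  have hirrG : Irreducible (bind₁ (lin M) F) := (MulEquiv.irreducible_iff Φ).mpr hirr
  have hlin : ∀ i, (lin M i).IsHomogeneous 1 := by
    intro i
    refine IsHomogeneous.sum _ _ _ fun j _ => ?_
    simpa using (isHomogeneous_C (Fin 3) (M i j)).mul (isHomogeneous_X ℂ j)
  have hG3 : (bind₁ (lin M) F).IsHomogeneous 3 := by
    simpa using h3.aeval (lin M) hlin
  have hpd : ∀ j u, eval u (pderiv j (bind₁ (lin M) F))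
      = ∑ i, eval (M.mulVec u) (pderiv i F) * M i j := by
    intro j u
    rw [chain]
    simp only [map_sum, map_mul, eval_lin]
    refine Finset.sum_congr rfl fun i _ => ?_
    congr 1
    fin_cases j <;> simp [lin, Fin.sum_univ_three, pderiv_X, Pi.single_apply]
  have hMe : M.mulVec ![1, 0, 0] = X := by
    ext i
    fin_cases i <;> simp [M, Matrix.mulVec, dotProduct, Fin.sum_univ_three]
  have e0 := eval_lin M ![1, 0, 0] F
  have e1 := hpd 1 ![1, 0, 0]
  have e2 := hpd 2 ![1, 0, 0]
  rw [hMe] at e0 e1 e2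
  simp only [Fin.sum_univ_three, hv0, hv1, hv2] at e1 e2
  rw [hXon] at e0
  have e1' : v0 * M 0 1 + v1 * M 1 1 + v2 * M 2 1 = 1 := by
    simp only [M, Matrix.of_apply, Matrix.cons_val]; exact hW
  have e2' : v0 * M 0 2 + v1 * M 1 2 + v2 * M 2 2 = 0 := by
    simp only [M, Matrix.of_apply, Matrix.cons_val]; ring
  rw [e1'] at e1
  rw [e2'] at e2
  obtain ⟨a, b, c, d, e, f, g, h, k, l, hG⟩ := exists_cub _ hG3
  rw [hG] at e0 e1 e2 hirrG
  have ha : a = 0 := by simpa [cub] using e0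
  have hb : b = 1 := by simpa [cub, pderiv_X, Pi.single_apply] using e1
  have hc : c = 0 := by simpa [cub, pderiv_X, Pi.single_apply] using e2
  subst ha hb hc
  obtain ⟨Y₁, Y₂, Y₃, Y₄, hY⟩ := core hirrG
  refine ⟨M.mulVec Y₁, M.mulVec Y₂, M.mulVec Y₃, M.mulVec Y₄, ?_⟩
  intro y hy0 hyF hyP hyX
  have hyu : y = M.mulVec (M⁻¹.mulVec y) := by
    rw [Matrix.mulVec_mulVec, hMN, Matrix.one_mulVec]
  generalize M⁻¹.mulVec y = u at hyu
  have h1 : u 1 ≠ 0 ∨ u 2 ≠ 0 := by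
    by_contra! hc
    refine hyX ⟨u 0, ?_⟩
    rw [hyu, ← hMe, ← Matrix.mulVec_smul]
    congr 1
    ext i
    fin_cases i <;> simp [hc.1, hc.2]
  have h2 := eval_lin M u F
  rw [← hyu, hyF, hG] at h2
  have h3 := hpd 0 u
  rw [← hyu, hG] at h3
  have h4 : ∑ i, eval y (pderiv i F) * M i 0 = 0 := by
    rw [← hyP]
    simp [Fin.sum_univ_three, M, mul_comm]
  rw [h4] at h3
  rcases hY u h1 h2 h3 with ⟨t, ht⟩ | ⟨t, ht⟩ | ⟨t, ht⟩ | ⟨t, ht⟩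
  · exact .inl ⟨t, by rw [hyu, ht, Matrix.mulVec_smul]⟩
  · exact .inr (.inl ⟨t, by rw [hyu, ht, Matrix.mulVec_smul]⟩)
  · exact .inr (.inr (.inl ⟨t, by rw [hyu, ht, Matrix.mulVec_smul]⟩))
  · exact .inr (.inr (.inr ⟨t, by rw [hyu, ht, Matrix.mulVec_smul]⟩))
end
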